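/- There exist a compact set C ⊆ ℝ² and a family of maps f_μ : ℝ² → ℝ², μ ∈ [−1,1], such that: each f_μ is C^1 and the maps (μ, z) ↦ f_μ(z) and (μ, z) ↦ D(f_μ)_z are jointly continuous; f_μ(z) = f_0(z) for every z ∉ C and every μ; for every μ, 0 is an expanding fixed point of f_μ, i.e. f_μ(0) = 0 and there is λ > 1 with ‖D(f_μ)_0(v)‖ ≥ λ‖v‖ for all v ∈ ℝ²; the unstable set W^u_{f_μ}(0) is the same subset of ℝ² for every μ ∈ [−1,1]; for every μ > 0 the map f_μ has a regular homoclinic orbit associated to 0; and for every μ ≤ 0 the map f_μ has no homoclinic orbit associated to 0. (In particular, the one-dimensional bifurcation theorem for the last homoclinic parameter fails in dimension two.) -/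

import Mathlib

open Filter Set

/-- The unstable set of the fixed point `p` of `f`: points having a preorbit
converging to `p`. -/
def unstableSet (f : EuclideanSpace ℝ (Fin 2) → EuclideanSpace ℝ (Fin 2))
    (p : EuclideanSpace ℝ (Fin 2)) : Set (EuclideanSpace ℝ (Fin 2)) :=
  {y | ∃ s : ℕ → EuclideanSpace ℝ (Fin 2), s 0 = y ∧
    (∀ n : ℕ, f (s (n + 1)) = s n) ∧ Tendsto s atTop (nhds p)}

/-- A homoclinic orbit of `f` associated to the fixed point `p`. -/
def IsHomoclinicOrbit (f : EuclideanSpace ℝ (Fin 2) → EuclideanSpace ℝ (Fin 2))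
    (p : EuclideanSpace ℝ (Fin 2)) (x : ℤ → EuclideanSpace ℝ (Fin 2)) : Prop :=
  (∀ n : ℤ, f (x (n + 1)) = x n) ∧
  Tendsto x atTop (nhds p) ∧ Tendsto x atBot (nhds p) ∧ ∃ N : ℤ, x N ≠ p

/-- If `f` and `g` agree off `K`, and `f` maps `K` into the unstable set of `g`, then the
unstable set of `f` is contained in that of `g`. -/
theorem unstableSet_subset_of_eqOn_compl
    {f g : EuclideanSpace ℝ (Fin 2) → EuclideanSpace ℝ (Fin 2)} {p : EuclideanSpace ℝ (Fin 2)}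
    {K : Set (EuclideanSpace ℝ (Fin 2))} (hfg : ∀ z ∉ K, f z = g z)
    (hK : ∀ z ∈ K, f z ∈ unstableSet g p) : unstableSet f p ⊆ unstableSet g p := by
  classical
  rintro y ⟨s, rfl, hs, hlim⟩
  by_cases hex : ∃ n, s (n + 1) ∈ K
  · have hforward : ∀ z ∈ unstableSet g p, g z ∈ unstableSet g p := by
      rintro z ⟨t, rfl, ht, htlim⟩
      refine ⟨fun n => Nat.casesOn n (g (t 0)) t, rfl, ?_, ?_⟩
      · rintro (_ | n)
        · rfl
        · exact ht n
      · exact (tendsto_add_atTop_iff_nat 1).1 htlim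
    have hback : ∀ k, (∀ j < k, s (j + 1) ∉ K) → s k ∈ unstableSet g p →
        s 0 ∈ unstableSet g p := by
      intro k
      induction k with
      | zero => exact fun _ h => h
      | succ k ih =>
        intro hj h
        refine ih (fun j hjk => hj j (by omega)) ?_
        rw [← hs k, hfg _ (hj k (by omega))]
        exact hforward _ h
    refine hback (Nat.find hex) (fun j hj => Nat.find_min hex hj) ?_
    rw [← hs]
    exact hK _ (Nat.find_spec hex)
  · push Not at hex
    exact ⟨s, rfl, fun n => by rw [← hfg _ (hex n), hs n], hlim⟩

/-- An orbit converging in forward time to a fixed point where the derivative is expanding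
eventually equals that fixed point. -/
theorem exists_eq_zero_of_tendsto_of_expanding
    {f : EuclideanSpace ℝ (Fin 2) → EuclideanSpace ℝ (Fin 2)} (hf : DifferentiableAt ℝ f 0)
    (h0 : f 0 = 0) (hexp : ∀ v, 2 * ‖v‖ ≤ ‖fderiv ℝ f 0 v‖)
    {x : ℕ → EuclideanSpace ℝ (Fin 2)} (hx : ∀ n, f (x n) = x (n + 1))
    (hlim : Tendsto x atTop (nhds 0)) : ∃ n, x n = 0 := by
  have hev : ∀ᶠ z in nhds 0, ‖z‖ ≤ ‖f z‖ := by
    filter_upwards [hf.hasFDerivAt.isLittleO.def one_pos] with z hz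
    simp only [h0, sub_zero, one_mul] at hz
    have h1 := hexp z
    have h2 := norm_sub_norm_le (fderiv ℝ f 0 z) (f z)
    rw [norm_sub_rev] at hz
    linarith
  obtain ⟨N, hN⟩ := eventually_atTop.1 (hlim.eventually hev)
  refine ⟨N, ?_⟩
  have hmono : Monotone fun n => ‖x (n + N)‖ := by
    refine monotone_nat_of_le_succ fun n => ?_
    have := hN (n + N) (by omega)
    rw [hx] at this
    rwa [show n + 1 + N = n + N + 1 by ring]
  have hlim' : Tendsto (fun n => ‖x (n + N)‖) atTop (nhds 0) := by
    simpa using ((tendsto_add_atTop_iff_nat N).2 hlim).norm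
  have := hmono.ge_of_tendsto hlim' 0
  simpa using this

noncomputable section

/-- The unperturbed map `(x, y) ↦ (exp (8 (1 - 2 y) x - 8 y²) - 1, 9/2 y (1 - y))`. -/
def baseMap (z : EuclideanSpace ℝ (Fin 2)) : EuclideanSpace ℝ (Fin 2) :=
  !₂[Real.exp (8 * (1 - 2 * z 1) * z 0 - 8 * z 1 ^ 2) - 1, 9 / 2 * z 1 * (1 - z 1)]

/-- The translate of `baseMap` along the first axis by a multiple of the function `b`. -/
def perturbedMap (b : EuclideanSpace ℝ (Fin 2) → ℝ) (c : ℝ) (z : EuclideanSpace ℝ (Fin 2)) :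
    EuclideanSpace ℝ (Fin 2) :=
  baseMap z + (c * b z) • EuclideanSpace.single 0 1

/-- A neighbourhood of the origin on which `baseMap` has a contracting inverse branch. -/
def localRegion : Set (EuclideanSpace ℝ (Fin 2)) := {z | -(1 / 2) ≤ z 0 ∧ |z 1| ≤ 2 / 3}

/-- The point other than the origin that `baseMap` sends to the origin. -/
def otherZero : EuclideanSpace ℝ (Fin 2) := !₂[-1, 1]

theorem baseMap_apply_zero (z : EuclideanSpace ℝ (Fin 2)) :
    baseMap z 0 = Real.exp (8 * (1 - 2 * z 1) * z 0 - 8 * z 1 ^ 2) - 1 := rfl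

theorem baseMap_apply_one (z : EuclideanSpace ℝ (Fin 2)) :
    baseMap z 1 = 9 / 2 * z 1 * (1 - z 1) := rfl

theorem plane_ext {z w : EuclideanSpace ℝ (Fin 2)} (h0 : z 0 = w 0) (h1 : z 1 = w 1) : z = w := by
  ext i
  fin_cases i
  · exact h0
  · exact h1

theorem baseMap_zero : baseMap 0 = 0 :=
  plane_ext (by simp [baseMap_apply_zero]) (by simp [baseMap_apply_one])

theorem baseMap_otherZero : baseMap otherZero = 0 :=
  plane_ext (by simp [baseMap_apply_zero, otherZero]; norm_num)
    (by simp [baseMap_apply_one, otherZero])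

theorem eq_zero_or_eq_otherZero_of_baseMap_eq_zero {z : EuclideanSpace ℝ (Fin 2)}
    (hz : baseMap z = 0) : z = 0 ∨ z = otherZero := by
  have h0 : baseMap z 0 = 0 := by rw [hz]; rfl
  have h1 : baseMap z 1 = 0 := by rw [hz]; rfl
  rw [baseMap_apply_zero, sub_eq_zero, Real.exp_eq_one_iff] at h0
  rw [baseMap_apply_one] at h1
  rcases mul_eq_zero.1 h1 with h | h
  · have hy : z 1 = 0 := by linarith
    rw [hy] at h0
    exact Or.inl (plane_ext (by simp; linarith) (by simpa using hy))
  · have hy : z 1 = 1 := by linarith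
    rw [hy] at h0
    exact Or.inr (plane_ext (by simp [otherZero]; linarith) (by simpa [otherZero] using hy))

theorem baseMap_ne_otherZero (z : EuclideanSpace ℝ (Fin 2)) : baseMap z ≠ otherZero := by
  intro h
  have h0 : baseMap z 0 = -1 := by rw [h]; rfl
  rw [baseMap_apply_zero] at h0
  linarith [Real.exp_pos (8 * (1 - 2 * z 1) * z 0 - 8 * z 1 ^ 2)]

theorem contDiff_baseMap : ContDiff ℝ 1 baseMap := by
  have hcoord : ∀ i : Fin 2, ContDiff ℝ 1 fun z : EuclideanSpace ℝ (Fin 2) => z i :=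
    fun i => (EuclideanSpace.proj (𝕜 := ℝ) i).contDiff
  have h0 := hcoord 0
  have h1 := hcoord 1
  rw [contDiff_euclidean]
  intro i
  fin_cases i
  · change ContDiff ℝ 1 fun z : EuclideanSpace ℝ (Fin 2) =>
      Real.exp (8 * (1 - 2 * z 1) * z 0 - 8 * z 1 ^ 2) - 1
    fun_prop
  · change ContDiff ℝ 1 fun z : EuclideanSpace ℝ (Fin 2) => 9 / 2 * z 1 * (1 - z 1)
    fun_prop

theorem fderiv_baseMap_apply (z v : EuclideanSpace ℝ (Fin 2)) :
    fderiv ℝ baseMap z v 0 = Real.exp (8 * (1 - 2 * z 1) * z 0 - 8 * z 1 ^ 2) *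
        (8 * (1 - 2 * z 1) * v 0 - (16 * z 0 + 16 * z 1) * v 1) ∧
      fderiv ℝ baseMap z v 1 = 9 / 2 * (1 - 2 * z 1) * v 1 := by
  have hd : ∀ i : Fin 2, HasFDerivAt (fun w => baseMap w i)
      ((EuclideanSpace.proj i : EuclideanSpace ℝ (Fin 2) →L[ℝ] ℝ) ∘L fderiv ℝ baseMap z) z :=
    fun i => (EuclideanSpace.proj i : EuclideanSpace ℝ (Fin 2) →L[ℝ] ℝ).hasFDerivAt.comp z
      ((contDiff_baseMap.differentiable one_ne_zero) z).hasFDerivAt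
  have h0 : HasFDerivAt (fun z : EuclideanSpace ℝ (Fin 2) => z 0)
      (EuclideanSpace.proj 0 : EuclideanSpace ℝ (Fin 2) →L[ℝ] ℝ) z :=
    (EuclideanSpace.proj 0 : EuclideanSpace ℝ (Fin 2) →L[ℝ] ℝ).hasFDerivAt
  have h1 : HasFDerivAt (fun z : EuclideanSpace ℝ (Fin 2) => z 1)
      (EuclideanSpace.proj 1 : EuclideanSpace ℝ (Fin 2) →L[ℝ] ℝ) z :=
    (EuclideanSpace.proj 1 : EuclideanSpace ℝ (Fin 2) →L[ℝ] ℝ).hasFDerivAt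
  have e0 := (((((((h1.const_mul 2).const_sub 1).const_mul 8).mul h0).sub
    ((h1.pow 2).const_mul 8)).exp).sub_const 1).unique (hd 0)
  have e1 := ((h1.const_mul (9 / 2)).mul (h1.const_sub 1)).unique (hd 1)
  constructor
  · have := congrArg (fun L : EuclideanSpace ℝ (Fin 2) →L[ℝ] ℝ => L v) e0
    simp at this
    rw [← this]
    ring
  · have := congrArg (fun L : EuclideanSpace ℝ (Fin 2) →L[ℝ] ℝ => L v) e1
    simp at this
    rw [← this]
    ring

theorem two_mul_norm_le_norm_fderiv_baseMap_zero (v : EuclideanSpace ℝ (Fin 2)) :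
    2 * ‖v‖ ≤ ‖fderiv ℝ baseMap 0 v‖ := by
  obtain ⟨h0, h1⟩ := fderiv_baseMap_apply 0 v
  simp at h0 h1
  refine le_of_sq_le_sq ?_ (norm_nonneg _)
  rw [mul_pow, EuclideanSpace.real_norm_sq_eq, EuclideanSpace.real_norm_sq_eq,
    Fin.sum_univ_two, Fin.sum_univ_two, h0, h1]
  nlinarith [sq_nonneg (v 0), sq_nonneg (v 1)]

theorem bijective_fderiv_baseMap {z : EuclideanSpace ℝ (Fin 2)} (hz : z 1 ≠ 1 / 2) :
    Function.Bijective (fderiv ℝ baseMap z) := by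
  have hz' : 1 - 2 * z 1 ≠ 0 := fun h => hz (by linarith)
  have hinj : Function.Injective (fderiv ℝ baseMap z) := by
    refine (injective_iff_map_eq_zero _).2 fun v hv => ?_
    obtain ⟨h0, h1⟩ := fderiv_baseMap_apply z v
    rw [hv] at h0 h1
    have hv1 : v 1 = 0 := by simpa [hz'] using h1
    rw [hv1] at h0
    have hv0 : v 0 = 0 := by simpa [hz', Real.exp_ne_zero] using h0
    exact plane_ext hv0 hv1
  exact ⟨hinj, LinearMap.injective_iff_surjective (f := (fderiv ℝ baseMap z).toLinearMap) |>.1 hinj⟩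

/-- The contracting inverse branch of `baseMap` on `localRegion`. -/
theorem exists_baseMap_eq {z : EuclideanSpace ℝ (Fin 2)} (hz : z ∈ localRegion) :
    ∃ w ∈ localRegion, baseMap w = z ∧ w 1 ≠ 1 / 2 ∧ |w 0| + |w 1| ≤ (|z 0| + |z 1|) / 2 := by
  obtain ⟨hx, hy⟩ := hz
  obtain ⟨hy1, hy2⟩ := abs_le.1 hy
  obtain ⟨y, ⟨hya, hyb⟩, hGy⟩ :
      z 1 ∈ (fun y : ℝ => 9 / 2 * y * (1 - y)) '' Icc (-(1 / 5)) (1 / 5) :=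
    intermediate_value_Icc (by norm_num) (by fun_prop) ⟨by norm_num; linarith, by norm_num; linarith⟩
  have hyabs : |y| ≤ 1 / 5 := abs_le.2 ⟨hya, hyb⟩
  have hm : 0 < 8 * (1 - 2 * y) := by linarith
  have hpos : 0 < 1 + z 0 := by linarith
  have hlog : |Real.log (1 + z 0)| ≤ 2 * |z 0| := by
    have hup := Real.log_le_sub_one_of_pos hpos
    have hlow := Real.one_sub_inv_le_log_of_pos hpos
    have hinv : 1 - (1 + z 0)⁻¹ = z 0 / (1 + z 0) := by field_simp; ring
    rw [hinv] at hlow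
    rw [abs_le]
    constructor
    · refine le_trans ?_ hlow
      rw [le_div_iff₀ hpos]
      nlinarith [abs_nonneg (z 0), neg_abs_le (z 0)]
    · linarith [le_abs_self (z 0), abs_nonneg (z 0)]
  have hloglow : -1 ≤ Real.log (1 + z 0) := by
    have hlow := Real.one_sub_inv_le_log_of_pos hpos
    have : (1 + z 0)⁻¹ ≤ 2 := by
      rw [inv_le_comm₀ hpos two_pos]
      linarith
    linarith
  set x := (Real.log (1 + z 0) + 8 * y ^ 2) / (8 * (1 - 2 * y)) with hxdef
  have hxm : 8 * (1 - 2 * y) * x = Real.log (1 + z 0) + 8 * y ^ 2 := by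
    rw [hxdef, mul_div_cancel₀ _ hm.ne']
  have hyz : 18 / 5 * |y| ≤ |z 1| := by
    rw [← hGy, abs_mul, abs_mul, abs_of_pos (show (0 : ℝ) < 9 / 2 by norm_num),
      abs_of_pos (show 0 < 1 - y by linarith)]
    nlinarith [abs_nonneg y]
  have hxz : 24 / 5 * |x| ≤ 2 * |z 0| + 8 / 5 * |y| := by
    have h1 : |8 * (1 - 2 * y) * x| ≤ 2 * |z 0| + 8 * y ^ 2 := by
      rw [hxm]
      refine (abs_add_le _ _).trans ?_
      rw [abs_of_nonneg (show 0 ≤ 8 * y ^ 2 by positivity)]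
      linarith
    rw [abs_mul, abs_of_pos hm] at h1
    have h2 : y ^ 2 ≤ 1 / 5 * |y| := by
      rw [← sq_abs]; nlinarith [abs_nonneg y]
    nlinarith [abs_nonneg x]
  refine ⟨!₂[x, y], ⟨?_, ?_⟩, plane_ext ?_ ?_, ?_, ?_⟩
  · change -(1 / 2) ≤ x
    rw [hxdef, le_div_iff₀ hm]
    nlinarith [sq_nonneg y]
  · change |y| ≤ 2 / 3
    linarith
  · rw [baseMap_apply_zero]
    change Real.exp (8 * (1 - 2 * y) * x - 8 * y ^ 2) - 1 = z 0
    rw [hxm, add_sub_cancel_right, Real.exp_log hpos]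
    ring
  · exact hGy
  · change y ≠ 1 / 2
    linarith
  · change |x| + |y| ≤ _
    linarith [abs_nonneg y, abs_nonneg (z 0)]

theorem exists_preorbit_baseMap {z : EuclideanSpace ℝ (Fin 2)} (hz : z ∈ localRegion) :
    ∃ s : ℕ → EuclideanSpace ℝ (Fin 2), s 0 = z ∧ (∀ n, s n ∈ localRegion) ∧
      (∀ n, baseMap (s (n + 1)) = s n) ∧ (∀ n, s (n + 1) 1 ≠ 1 / 2) ∧
      Tendsto s atTop (nhds 0) := by
  choose g hgmem hgmap hgreg hgle using
    fun w : localRegion => exists_baseMap_eq (z := w) w.2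
  let t : ℕ → localRegion := fun n => (fun w => ⟨g w, hgmem w⟩)^[n] ⟨z, hz⟩
  have ht : ∀ n, (t (n + 1) : EuclideanSpace ℝ (Fin 2)) = g (t n) := fun n => by
    simp only [t, Function.iterate_succ_apply']
  refine ⟨fun n => t n, rfl, fun n => (t n).2, fun n => ?_, fun n => ?_, ?_⟩
  · change baseMap (t (n + 1)) = t n
    rw [ht, hgmap]
  · change (t (n + 1) : EuclideanSpace ℝ (Fin 2)) 1 ≠ 1 / 2
    rw [ht]
    exact hgreg _
  · have hV : ∀ n, |(t n : EuclideanSpace ℝ (Fin 2)) 0| + |(t n : EuclideanSpace ℝ (Fin 2)) 1| ≤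
        (|z 0| + |z 1|) * (1 / 2) ^ n := by
      intro n
      induction n with
      | zero => simp [t]
      | succ n ih =>
        rw [ht, pow_succ]
        linarith [hgle (t n)]
    have hlim : Tendsto (fun n : ℕ => (|z 0| + |z 1|) * (1 / 2 : ℝ) ^ n) atTop (nhds 0) := by
      simpa using (tendsto_pow_atTop_nhds_zero_of_lt_one (by norm_num : (0 : ℝ) ≤ 1 / 2)
        (by norm_num)).const_mul (|z 0| + |z 1|)
    refine squeeze_zero_norm (fun n => le_trans ?_ (hV n)) hlim
    rw [EuclideanSpace.norm_eq, Fin.sum_univ_two, Real.norm_eq_abs, Real.norm_eq_abs]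
    refine Real.sqrt_le_iff.2 ⟨by positivity, ?_⟩
    nlinarith [mul_nonneg (abs_nonneg ((t n : EuclideanSpace ℝ (Fin 2)) 0))
      (abs_nonneg ((t n : EuclideanSpace ℝ (Fin 2)) 1))]

theorem perturbedMap_eq_baseMap {b : EuclideanSpace ℝ (Fin 2) → ℝ}
    {z : EuclideanSpace ℝ (Fin 2)} (hz : b z = 0) (c : ℝ) : perturbedMap b c z = baseMap z := by
  simp [perturbedMap, hz]

theorem perturbedMap_zero_param (b : EuclideanSpace ℝ (Fin 2) → ℝ) :
    perturbedMap b 0 = baseMap := by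
  ext1 z
  simp [perturbedMap]

theorem fderiv_perturbedMap {b : EuclideanSpace ℝ (Fin 2) → ℝ} (hb : ContDiff ℝ 1 b) (c : ℝ)
    (z : EuclideanSpace ℝ (Fin 2)) :
    fderiv ℝ (perturbedMap b c) z = fderiv ℝ baseMap z +
      (c • fderiv ℝ b z).smulRight (EuclideanSpace.single 0 1) :=
  (((contDiff_baseMap.differentiable one_ne_zero) z).hasFDerivAt.add
    ((((hb.differentiable one_ne_zero) z).hasFDerivAt.const_mul c).smul_const
      (EuclideanSpace.single 0 1))).fderiv

theorem localRegion_subset_unstableSet {b : EuclideanSpace ℝ (Fin 2) → ℝ}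
    (hb : ∀ z ∈ localRegion, b z = 0) (c : ℝ) :
    localRegion ⊆ unstableSet (perturbedMap b c) 0 := by
  intro z hz
  obtain ⟨s, hs0, hsD, hs, -, hlim⟩ := exists_preorbit_baseMap hz
  exact ⟨s, hs0, fun n => by rw [perturbedMap_eq_baseMap (hb _ (hsD _)), hs], hlim⟩

theorem unstableSet_perturbedMap {b : EuclideanSpace ℝ (Fin 2) → ℝ} (hb0 : ∀ z, 0 ≤ b z)
    (hb : ∀ z ∈ localRegion, b z = 0) (hbmap : ∀ z, b z ≠ 0 → baseMap z ∈ localRegion)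
    {c : ℝ} (hc : 0 ≤ c) : unstableSet (perturbedMap b c) 0 = unstableSet baseMap 0 := by
  have hbase := localRegion_subset_unstableSet hb 0
  rw [perturbedMap_zero_param] at hbase
  have hagree : ∀ z ∉ {z | b z ≠ 0}, perturbedMap b c z = baseMap z :=
    fun z hz => perturbedMap_eq_baseMap (not_not.1 hz) c
  refine Subset.antisymm (unstableSet_subset_of_eqOn_compl hagree fun z hz => hbase ?_)
    (unstableSet_subset_of_eqOn_compl (fun z hz => (hagree z hz).symm)
      fun z hz => localRegion_subset_unstableSet hb c (hbmap z hz))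
  obtain ⟨h0, h1⟩ := hbmap z hz
  have := mul_nonneg hc (hb0 z)
  exact ⟨by simp [perturbedMap]; linarith, by simpa [perturbedMap] using h1⟩

theorem not_exists_isHomoclinicOrbit_baseMap : ¬ ∃ x, IsHomoclinicOrbit baseMap 0 x := by
  rintro ⟨x, hx, -, hbot, N, hN⟩
  have hneg : Tendsto (fun n : ℕ => -(n : ℤ)) atTop atBot :=
    tendsto_neg_atTop_atBot.comp tendsto_natCast_atTop_atTop
  obtain ⟨n, hn⟩ := exists_eq_zero_of_tendsto_of_expanding
    ((contDiff_baseMap.differentiable one_ne_zero) 0) baseMap_zero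
    two_mul_norm_le_norm_fderiv_baseMap_zero
    (x := fun n : ℕ => x (-(n : ℤ)))
    (fun n => by rw [← hx (-((n + 1 : ℕ) : ℤ))]; congr 2; push_cast; ring) (hbot.comp hneg)
  have hstep : ∀ m, x m = 0 → x (m + 1) = 0 := by
    intro m hm
    rcases eq_zero_or_eq_otherZero_of_baseMap_eq_zero ((hx m).trans hm) with h | h
    · exact h
    · exact absurd ((hx (m + 1)).trans h) (baseMap_ne_otherZero _)
  have hback : ∀ m, x (m + 1) = 0 → x m = 0 := fun m hm => by rw [← hx, hm, baseMap_zero]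
  refine hN (Int.inductionOn' N (-(n : ℤ)) hn (fun k _ h => hstep k h) fun k _ h => hback _ ?_)
  simpa using h

/-- If `b = 1` at a point slightly to the right of `otherZero`, then pushing the image of that
point to the origin creates a regular homoclinic orbit. -/
theorem exists_regular_homoclinicOrbit {b : EuclideanSpace ℝ (Fin 2) → ℝ} (hb1 : ContDiff ℝ 1 b)
    (hb0 : ∀ z, 0 ≤ b z) (hble : ∀ z, b z ≤ 1) (hb : ∀ z ∈ localRegion, b z = 0)
    {ε : ℝ} (hε : 0 < ε) (hε4 : ε ≤ Real.exp (-4)) (hbε : b !₂[-1 + ε, 1] = 1) :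
    ∃ x, IsHomoclinicOrbit (perturbedMap b (1 - Real.exp (-8 * ε))) 0 x ∧
      ∀ n, Function.Bijective (fderiv ℝ (perturbedMap b (1 - Real.exp (-8 * ε))) (x n)) := by
  set c := 1 - Real.exp (-8 * ε) with hc
  have hreg : ∀ z : EuclideanSpace ℝ (Fin 2), fderiv ℝ b z = 0 → z 1 ≠ 1 / 2 →
      Function.Bijective (fderiv ℝ (perturbedMap b c) z) := by
    intro z hbz hz
    have : fderiv ℝ (perturbedMap b c) z = fderiv ℝ baseMap z := by
      rw [fderiv_perturbedMap hb1, hbz]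
      ext1 v
      simp
    rw [this]
    exact bijective_fderiv_baseMap hz
  have hfderiv : ∀ z ∈ localRegion, fderiv ℝ b z = 0 := fun z hz =>
    IsLocalMin.fderiv_eq_zero (Eventually.of_forall fun w => by rw [hb z hz]; exact hb0 w)
  have hfderiv' : fderiv ℝ b !₂[-1 + ε, 1] = 0 :=
    IsLocalMax.fderiv_eq_zero (Eventually.of_forall fun w => by rw [hbε]; exact hble w)
  have h0mem : (0 : EuclideanSpace ℝ (Fin 2)) ∈ localRegion := by
    constructor <;> simp
    norm_num
  have hlogε : Real.log ε ≤ -4 := (Real.log_le_iff_le_exp hε).2 hε4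
  obtain ⟨s, hs0, hsD, hs, hsreg, hlim⟩ :=
    exists_preorbit_baseMap (z := !₂[-(3 / 8) * (Real.log ε + 32 / 9), 2 / 3])
      ⟨by change -(1 / 2) ≤ -(3 / 8) * (Real.log ε + 32 / 9); linarith,
        by change |(2 / 3 : ℝ)| ≤ 2 / 3; norm_num⟩
  have hsreg' : ∀ n, s n 1 ≠ 1 / 2 := by
    rintro (_ | n)
    · rw [hs0]
      change (2 / 3 : ℝ) ≠ 1 / 2
      norm_num
    · exact hsreg n
  have hmap0 : perturbedMap b c 0 = 0 := by
    rw [perturbedMap_eq_baseMap (hb _ h0mem), baseMap_zero]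
  have hmapε : perturbedMap b c !₂[-1 + ε, 1] = 0 := by
    refine plane_ext ?_ ?_
    · simp [perturbedMap, baseMap_apply_zero, hbε, hc]
      ring_nf
    · simp [perturbedMap, baseMap_apply_one]
  have hmaps : perturbedMap b c (s 0) = !₂[-1 + ε, 1] := by
    rw [perturbedMap_eq_baseMap (hb _ (hsD 0)), hs0]
    refine plane_ext ?_ ?_
    · rw [baseMap_apply_zero]
      change Real.exp (8 * (1 - 2 * (2 / 3)) * (-(3 / 8) * (Real.log ε + 32 / 9)) -
        8 * (2 / 3) ^ 2) - 1 = -1 + ε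
      rw [show 8 * (1 - 2 * (2 / 3)) * (-(3 / 8) * (Real.log ε + 32 / 9)) -
        8 * (2 / 3) ^ 2 = Real.log ε by ring, Real.exp_log hε]
      ring
    · rw [baseMap_apply_one]
      change 9 / 2 * (2 / 3 : ℝ) * (1 - 2 / 3) = 1
      norm_num
  let x : ℤ → EuclideanSpace ℝ (Fin 2)
    | Int.ofNat 0 => !₂[-1 + ε, 1]
    | Int.ofNat (n + 1) => s n
    | Int.negSucc _ => 0
  refine ⟨x, ⟨?_, ?_, ?_, 0, ?_⟩, ?_⟩
  · rintro ((_ | n) | (_ | n))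
    · exact hmaps
    · change perturbedMap b c (s (n + 1)) = s n
      rw [perturbedMap_eq_baseMap (hb _ (hsD _)), hs]
    · exact hmapε
    · exact hmap0
  · have h : Tendsto (fun n : ℕ => x ((n + 1 : ℕ) : ℤ)) atTop (nhds 0) := hlim
    have h' : Tendsto (fun n : ℕ => x (n : ℤ)) atTop (nhds 0) :=
      (tendsto_add_atTop_iff_nat (f := fun n : ℕ => x (n : ℤ)) 1).1 h
    rwa [← Nat.map_cast_int_atTop, tendsto_map'_iff]
  · refine tendsto_const_nhds.congr' ?_
    filter_upwards [eventually_lt_atBot (0 : ℤ)] with n hn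
    obtain ⟨k, rfl⟩ := Int.eq_negSucc_of_lt_zero hn
    rfl
  · intro h
    have : (1 : ℝ) = 0 := congrArg (fun z : EuclideanSpace ℝ (Fin 2) => z 1) h
    norm_num at this
  · rintro ((_ | n) | n)
    · exact hreg _ hfderiv' (by change (1 : ℝ) ≠ 1 / 2; norm_num)
    · exact hreg _ (hfderiv _ (hsD n)) (hsreg' n)
    · exact hreg _ (hfderiv _ h0mem) (by change (0 : ℝ) ≠ 1 / 2; norm_num)

/-- A bump function near `otherZero` supported away from `localRegion` and mapped into it. -/
theorem exists_bump : ∃ b : ContDiffBump otherZero,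
    (∀ z ∈ localRegion, b z = 0) ∧ ∀ z, b z ≠ 0 → baseMap z ∈ localRegion := by
  have hcont : Tendsto baseMap (nhds otherZero) (nhds 0) := by
    simpa only [baseMap_otherZero] using contDiff_baseMap.continuous.tendsto otherZero
  obtain ⟨r, hr, hball⟩ := Metric.eventually_nhds_iff_ball.1
    (hcont.eventually (Metric.ball_mem_nhds 0 (by norm_num : (0 : ℝ) < 1 / 2)))
  refine ⟨⟨min r (1 / 3) / 2, min r (1 / 3), by positivity, half_lt_self (by positivity)⟩, ?_, ?_⟩
  · rintro z ⟨-, hz⟩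
    refine ContDiffBump.zero_of_le_dist _ ((min_le_right _ _).trans ?_)
    have h := PiLp.norm_apply_le (z - otherZero) 1
    rw [dist_eq_norm]
    refine le_trans ?_ h
    have h1 : (z - otherZero) 1 = z 1 - 1 := rfl
    rw [h1, Real.norm_eq_abs, abs_sub_comm]
    exact le_trans (by linarith [le_abs_self (z 1)]) (le_abs_self _)
  · intro z hz
    have hlt := not_le.1 (mt (ContDiffBump.zero_of_le_dist _) hz)
    have h := hball z (hlt.trans_le (min_le_left _ _))
    rw [dist_zero_right] at h
    have h0 := (PiLp.norm_apply_le (baseMap z) 0).trans h.le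
    have h1 := (PiLp.norm_apply_le (baseMap z) 1).trans h.le
    rw [Real.norm_eq_abs] at h0 h1
    exact ⟨(abs_le.1 h0).1, by linarith⟩

end

/-- There is a one-parameter family `f_μ : ℝ² → ℝ²`,
`μ ∈ [-1,1]`, of `C¹` maps, jointly continuous together with their derivatives,
all equal outside a fixed compact set, all having `0` as an expanding fixed
point with the same unstable set, such that `f_μ` has a regular homoclinic
orbit associated to `0` precisely when `μ > 0` and no homoclinic orbit at all
when `μ ≤ 0`.  Hence the one-dimensional bifurcation theorem for the last
homoclinic parameter fails in dimension two. -/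
theorem two_dimensional_homoclinic_bifurcation_example :
    ∃ (C : Set (EuclideanSpace ℝ (Fin 2)))
      (f : ℝ → EuclideanSpace ℝ (Fin 2) → EuclideanSpace ℝ (Fin 2)),
      IsCompact C ∧
      (∀ μ : ℝ, ContDiff ℝ 1 (f μ)) ∧
      Continuous (fun q : ℝ × EuclideanSpace ℝ (Fin 2) => f q.1 q.2) ∧
      Continuous (fun q : ℝ × EuclideanSpace ℝ (Fin 2) => fderiv ℝ (f q.1) q.2) ∧
      (∀ μ : ℝ, ∀ z ∉ C, f μ z = f 0 z) ∧
      (∀ μ : ℝ, f μ 0 = 0) ∧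
      (∀ μ : ℝ, ∃ lam > (1 : ℝ), ∀ v : EuclideanSpace ℝ (Fin 2),
        lam * ‖v‖ ≤ ‖fderiv ℝ (f μ) 0 v‖) ∧
      (∃ Wu : Set (EuclideanSpace ℝ (Fin 2)), ∀ μ ∈ Icc (-1 : ℝ) 1,
        unstableSet (f μ) 0 = Wu) ∧
      (∀ μ : ℝ, 0 < μ → μ ≤ 1 →
        ∃ x : ℤ → EuclideanSpace ℝ (Fin 2), IsHomoclinicOrbit (f μ) 0 x ∧
          ∀ n : ℤ, Function.Bijective (fderiv ℝ (f μ) (x n))) ∧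
      (∀ μ : ℝ, -1 ≤ μ → μ ≤ 0 →
        ¬ ∃ x : ℤ → EuclideanSpace ℝ (Fin 2), IsHomoclinicOrbit (f μ) 0 x) := by
  obtain ⟨b, hb, hbmap⟩ := exists_bump
  have hb1 : ContDiff ℝ 1 b := b.contDiff
  have hb0 : ∀ z, 0 ≤ b z := fun z => b.nonneg
  have h0mem : (0 : EuclideanSpace ℝ (Fin 2)) ∈ localRegion := by
    constructor <;> simp
    norm_num
  have hη : 0 < min b.rIn (Real.exp (-4)) := lt_min b.rIn_pos (Real.exp_pos _)
  set η := min b.rIn (Real.exp (-4))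
  have hc : ∀ μ : ℝ, 0 ≤ 1 - Real.exp (-8 * (η * max μ 0)) := fun μ => by
    have : 0 ≤ η * max μ 0 := by positivity
    rw [sub_nonneg, Real.exp_le_one_iff]
    linarith
  have hcneg : ∀ μ ≤ 0, 1 - Real.exp (-8 * (η * max μ 0)) = 0 := fun μ hμ => by
    rw [max_eq_right hμ]
    simp
  have hbase := contDiff_baseMap
  refine ⟨Metric.closedBall otherZero b.rOut,
    fun μ => perturbedMap b (1 - Real.exp (-8 * (η * max μ 0))),
    isCompact_closedBall _ _, fun μ => ?_, ?_, ?_, fun μ z hz => ?_, fun μ => ?_,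
    fun μ => ⟨2, one_lt_two, fun v => ?_⟩,
    ⟨unstableSet baseMap 0, fun μ _ => unstableSet_perturbedMap hb0 hb hbmap (hc μ)⟩,
    fun μ hμ hμ1 => ?_, fun μ _ hμ => ?_⟩
  · unfold perturbedMap
    fun_prop
  · have h1 := hbase.continuous
    have h2 := hb1.continuous
    unfold perturbedMap
    fun_prop
  · have h1 := hbase.continuous_fderiv one_ne_zero
    have h2 := hb1.continuous_fderiv one_ne_zero
    simp only [fderiv_perturbedMap hb1]
    have h3 : Continuous fun L : EuclideanSpace ℝ (Fin 2) →L[ℝ] ℝ =>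
        L.smulRight (EuclideanSpace.single (0 : Fin 2) (1 : ℝ)) :=
      ((ContinuousLinearMap.smulRightL ℝ (EuclideanSpace ℝ (Fin 2)) (EuclideanSpace ℝ (Fin 2))).flip
        (EuclideanSpace.single 0 1)).continuous
    have h4 : Continuous fun q : ℝ × EuclideanSpace ℝ (Fin 2) =>
        (1 - Real.exp (-8 * (η * max q.1 0))) • fderiv ℝ b q.2 :=
      have hc' : Continuous fun q : ℝ × EuclideanSpace ℝ (Fin 2) =>
          1 - Real.exp (-8 * (η * max q.1 0)) := by fun_prop
      hc'.smul (h2.comp continuous_snd)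
    exact (h1.comp continuous_snd).add (h3.comp h4)
  · have hbz : b z = 0 := b.zero_of_le_dist (not_le.1 hz).le
    simp only [perturbedMap_eq_baseMap hbz]
  · simp only [perturbedMap_eq_baseMap (hb 0 h0mem), baseMap_zero]
  · have hfd : fderiv ℝ b 0 = 0 :=
      IsLocalMin.fderiv_eq_zero (Eventually.of_forall fun w => by rw [hb 0 h0mem]; exact hb0 w)
    rw [fderiv_perturbedMap hb1, hfd]
    simpa using two_mul_norm_le_norm_fderiv_baseMap_zero v
  · simp only [max_eq_left hμ.le]
    have hle : η * μ ≤ η := mul_le_of_le_one_right hη.le hμ1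
    refine exists_regular_homoclinicOrbit hb1 hb0 (fun z => b.le_one) hb (mul_pos hη hμ)
      (hle.trans (min_le_right _ _)) (b.one_of_mem_closedBall ?_)
    have hsub : !₂[-1 + η * μ, 1] - otherZero = EuclideanSpace.single 0 (η * μ) :=
      plane_ext (by simp [otherZero]) (by simp [otherZero])
    rw [mem_closedBall_iff_norm, hsub, PiLp.norm_single, Real.norm_eq_abs,
      abs_of_pos (mul_pos hη hμ)]
    exact hle.trans (min_le_left _ _)
  · simp only [hcneg μ hμ, perturbedMap_zero_param]
    exact not_exists_isHomoclinicOrbit_baseMap
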